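/- (Attainment of the minimum cost.) Let n m : ℕ, let T ⊆ ℝ be nonempty and compact, let Γ : ℝ → Matrix (Fin n) (Fin m) ℝ be continuous, and let ω ∈ ℝⁿ satisfy ω ∈ S*(c̄,T) for some c̄ ≥ 0. Then the infimum c_opt = inf{c ≥ 0 : ω ∈ S*(c,T)} is attained: ω ∈ S*(c_opt,T). -/

import Mathlib

open Matrix
open scoped RealInnerProductSpace

/-- Single-impulse reachable set `S(c,T)`: states reachable by one impulse of cost at most `c`
applied at some time in `T`. -/
noncomputable def singleReach (n m : ℕ) (Γ : ℝ → Matrix (Fin n) (Fin m) ℝ) (c : ℝ) (T : Set ℝ) :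
    Set (EuclideanSpace ℝ (Fin n)) :=
  {y | ∃ t ∈ T, ∃ u : EuclideanSpace ℝ (Fin m), ‖u‖ ≤ c ∧ y = (Γ t).mulVec u}

/-- Multi-impulse reachable set `S*(c,T)`: states reachable by finitely many impulses at times in
`T` of total cost at most `c`. -/
noncomputable def multiReach (n m : ℕ) (Γ : ℝ → Matrix (Fin n) (Fin m) ℝ) (c : ℝ) (T : Set ℝ) :
    Set (EuclideanSpace ℝ (Fin n)) :=
  {y | ∃ k : ℕ, ∃ t : Fin k → ℝ, ∃ u : Fin k → EuclideanSpace ℝ (Fin m),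
      (∀ j, t j ∈ T) ∧ (∑ j, ‖u j‖) ≤ c ∧ y = ∑ j, (Γ (t j)).mulVec (u j)}


section

open scoped Pointwise

/-- In a finite-dimensional real normed space, the convex hull of a compact set is compact. -/
theorem isCompact_convexHull_of_finiteDimensional {E : Type*} [NormedAddCommGroup E]
    [NormedSpace ℝ E] [FiniteDimensional ℝ E] {s : Set E} (hs : IsCompact s) :
    IsCompact (convexHull ℝ s) := by
  have key : convexHull ℝ s = ⋃ k ∈ Set.Iic (Module.finrank ℝ E + 1),
      (fun p : (Fin k → ℝ) × (Fin k → E) => ∑ i, p.1 i • p.2 i) ''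
        (stdSimplex ℝ (Fin k) ×ˢ Set.univ.pi fun _ => s) := by
    apply Set.Subset.antisymm
    · intro x hx
      obtain ⟨ι, _, z, w, hz, hind, hw, hw1, hx⟩ := eq_pos_convex_span_of_mem_convexHull hx
      have hcard : Fintype.card ι ≤ Module.finrank ℝ E + 1 :=
        hind.card_le_finrank_succ.trans (by gcongr; exact Submodule.finrank_le _)
      let e := Fintype.equivFin ι
      refine Set.mem_biUnion hcard ⟨(w ∘ e.symm, z ∘ e.symm), ⟨⟨fun i => (hw _).le, ?_⟩,
        fun i _ => hz (Set.mem_range_self _)⟩, ?_⟩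
      · rw [← hw1]
        exact e.symm.sum_comp w
      · rw [← hx]
        exact e.symm.sum_comp fun i => w i • z i
    · refine Set.iUnion₂_subset fun k _ => ?_
      rintro _ ⟨⟨w, z⟩, ⟨⟨hw, hw1⟩, hz⟩, rfl⟩
      exact (convex_convexHull ℝ s).sum_mem (fun i _ => hw i) hw1
        fun i _ => subset_convexHull ℝ s (hz i trivial)
  rw [key]
  refine (Set.finite_Iic _).isCompact_biUnion fun k _ => ?_
  exact ((isCompact_stdSimplex ℝ (Fin k)).prod (isCompact_univ_pi fun _ => hs)).image (by fun_prop)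

theorem Convex.sum_mem_sum_smul {E ι : Type*} [AddCommGroup E] [Module ℝ E] {s : Set E}
    (hs : Convex ℝ s) (hne : s.Nonempty) (I : Finset ι) {w : ι → ℝ} {f : ι → E}
    (hw : ∀ i, 0 ≤ w i) (hf : ∀ i, f i ∈ w i • s) :
    ∑ i ∈ I, f i ∈ (∑ i ∈ I, w i) • s := by
  classical
  induction I using Finset.induction_on with
  | empty => simp [Set.zero_smul_set hne]
  | insert a I ha ih =>
    rw [Finset.sum_insert ha, Finset.sum_insert ha,
      hs.add_smul (hw a) (Finset.sum_nonneg fun i _ => hw i)]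
    exact Set.add_mem_add (hf a) ih

theorem Convex.smul_set_subset_smul_set {E : Type*} [AddCommGroup E] [Module ℝ E] {s : Set E}
    (hs : Convex ℝ s) (h0 : (0 : E) ∈ s) {a b : ℝ} (ha : 0 ≤ a) (hab : a ≤ b) :
    a • s ⊆ b • s := by
  intro x hx
  rw [← add_sub_cancel a b, hs.add_smul ha (sub_nonneg.2 hab), ← add_zero x]
  exact Set.add_mem_add hx ⟨0, h0, smul_zero _⟩

theorem isCompact_singleReach {n m : ℕ} {T : Set ℝ} (hT : IsCompact T)
    {Γ : ℝ → Matrix (Fin n) (Fin m) ℝ} (hΓ : Continuous Γ) (c : ℝ) :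
    IsCompact (singleReach n m Γ c T) := by
  have h : singleReach n m Γ c T =
      (fun p : ℝ × EuclideanSpace ℝ (Fin m) => WithLp.toLp 2 (Γ p.1 *ᵥ p.2.ofLp)) ''
        (T ×ˢ Metric.closedBall 0 c) := by
    ext y
    constructor
    · rintro ⟨t, ht, u, hu, hy⟩
      exact ⟨(t, u), ⟨ht, by simpa using hu⟩, by ext i; simp [hy]⟩
    · rintro ⟨⟨t, u⟩, ⟨ht, hu⟩, rfl⟩
      exact ⟨t, ht, u, by simpa using hu, rfl⟩
  rw [h]
  refine (hT.prod (isCompact_closedBall _ _)).image ?_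
  exact (PiLp.continuous_toLp 2 _).comp ((hΓ.comp continuous_fst).matrix_mulVec
    ((PiLp.continuous_ofLp 2 _).comp continuous_snd))

/-- The multi-impulse reachable set is the dilated convex hull of the unit-cost single-impulse
reachable set. -/
theorem multiReach_eq_smul_convexHull {n m : ℕ} {T : Set ℝ} (hT : T.Nonempty)
    (Γ : ℝ → Matrix (Fin n) (Fin m) ℝ) {c : ℝ} (hc : 0 ≤ c) :
    multiReach n m Γ c T = c • convexHull ℝ (singleReach n m Γ 1 T) := by
  have h0 : (0 : EuclideanSpace ℝ (Fin n)) ∈ convexHull ℝ (singleReach n m Γ 1 T) := by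
    obtain ⟨t, ht⟩ := hT
    exact subset_convexHull ℝ _ ⟨t, ht, 0, by simp, by simp⟩
  have hconv := convex_convexHull ℝ (singleReach n m Γ 1 T)
  apply Set.Subset.antisymm
  · rintro y ⟨k, t, u, ht, hu, hy⟩
    have hy' : y = ∑ j, WithLp.toLp 2 (Γ (t j) *ᵥ (u j).ofLp) := by
      apply WithLp.ofLp_injective 2
      simpa using hy
    rw [hy']
    refine hconv.smul_set_subset_smul_set h0 (Finset.sum_nonneg fun j _ => norm_nonneg (u j)) hu
      (hconv.sum_mem_sum_smul ⟨0, h0⟩ _ (fun j => norm_nonneg (u j)) fun j => ?_)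
    refine ⟨WithLp.toLp 2 (Γ (t j) *ᵥ (‖u j‖⁻¹ • u j).ofLp),
      subset_convexHull ℝ _ ⟨t j, ht j, ‖u j‖⁻¹ • u j, ?_, rfl⟩, ?_⟩
    · rw [norm_smul, norm_inv, norm_norm]
      exact inv_mul_le_one
    · rcases eq_or_ne (u j) 0 with h | h
      · simp [h]
      · simp [Matrix.mulVec_smul, smul_smul, mul_inv_cancel₀ (norm_ne_zero_iff.2 h)]
  · rintro _ ⟨x, hx, rfl⟩
    obtain ⟨ι, _, w, z, hw, hw1, hz, rfl⟩ := mem_convexHull_iff_exists_fintype.1 hx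
    choose t ht u hu hz using hz
    let e := (Fintype.equivFin ι).symm
    refine ⟨Fintype.card ι, t ∘ e, fun j => (c * w (e j)) • u (e j), fun j => ht _, ?_, ?_⟩
    · rw [e.sum_comp fun i => ‖(c * w i) • u i‖]
      calc ∑ i, ‖(c * w i) • u i‖ ≤ ∑ i, c * w i := by
            refine Finset.sum_le_sum fun i _ => ?_
            rw [norm_smul, Real.norm_of_nonneg (mul_nonneg hc (hw i))]
            exact mul_le_of_le_one_right (mul_nonneg hc (hw i)) (hu i)
        _ = c := by rw [← Finset.mul_sum, hw1, mul_one]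
    · refine Eq.trans ?_ (e.sum_comp fun i => Γ (t i) *ᵥ ((c * w i) • u i).ofLp).symm
      simp [Matrix.mulVec_smul, hz, Finset.smul_sum, smul_smul]

end

/-- Attainment of the minimum cost: for nonempty compact `T`, continuous `Γ`, and reachable `ω`,
the infimum `c_opt = inf {c ≥ 0 : ω ∈ S*(c,T)}` is attained, i.e. `ω ∈ S*(c_opt, T)`. -/
theorem minimum_cost_attained (n m : ℕ) (T : Set ℝ) (hT : T.Nonempty) (hTc : IsCompact T)
    (Γ : ℝ → Matrix (Fin n) (Fin m) ℝ) (hΓ : Continuous Γ)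
    (ω : EuclideanSpace ℝ (Fin n)) (cbar : ℝ) (hcbar : 0 ≤ cbar)
    (hω : ω ∈ multiReach n m Γ cbar T) :
    ω ∈ multiReach n m Γ (sInf {c : ℝ | 0 ≤ c ∧ ω ∈ multiReach n m Γ c T}) T := by
  set K := convexHull ℝ (singleReach n m Γ 1 T)
  have : CompactSpace K := isCompact_iff_compactSpace.1
    (isCompact_convexHull_of_finiteDimensional (isCompact_singleReach hTc hΓ 1))
  set C := {c : ℝ | 0 ≤ c ∧ ω ∈ multiReach n m Γ c T}
  have hCeq : C = Prod.fst ''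
      {p : ℝ × K | 0 ≤ p.1 ∧ p.1 • (p.2 : EuclideanSpace ℝ (Fin n)) = ω} := by
    ext c
    constructor
    · rintro ⟨hc, h⟩
      rw [multiReach_eq_smul_convexHull hT Γ hc] at h
      obtain ⟨x, hx, h⟩ := h
      exact ⟨(c, ⟨x, hx⟩), ⟨hc, h⟩, rfl⟩
    · rintro ⟨⟨c, x⟩, ⟨hc, h⟩, rfl⟩
      refine ⟨hc, ?_⟩
      rw [multiReach_eq_smul_convexHull hT Γ hc]
      exact ⟨x, x.2, h⟩
  have hclosed : IsClosed C := by
    rw [hCeq]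
    refine isClosedMap_fst_of_compactSpace _ ?_
    exact (isClosed_le continuous_const continuous_fst).inter
      (isClosed_eq (by fun_prop) continuous_const)
  exact (hclosed.csInf_mem ⟨cbar, hcbar, hω⟩ ⟨0, fun c hc => hc.1⟩).2
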